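/- Let N ≥ 2 be an integer and define v on Ω = {x ∈ ℝ^N : |x| ≥ 3} by v(x) = (|x|^{N/2} · log|x|)^{−1}. Then: (i) x ↦ v(x)² is integrable on Ω; (ii) x ↦ ‖∇v(x)‖² is integrable on Ω (the gradient being taken on the open set |x| > 2, where the formula defines a smooth function); but (iii) x ↦ v(x)² · log(v(x)²) is NOT integrable on Ω — indeed v(x)² log(v(x)²) ≤ 0 on Ω and ∫_Ω v² log(v²) dx = −∞. -/

import Mathlib

open MeasureTheory

/-- The function `v(x) = (|x|^{N/2} log|x|)⁻¹` of the paper's introduction. -/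
noncomputable def vfun (N : ℕ) (x : EuclideanSpace ℝ (Fin N)) : ℝ :=
  (‖x‖ ^ ((N : ℝ) / 2) * Real.log ‖x‖)⁻¹

/-- The radial profile `r ↦ (r^a log r)⁻¹`. -/
noncomputable def invRpowMulLog (a r : ℝ) : ℝ := (r ^ a * Real.log r)⁻¹

theorem one_lt_log_of_three_le {r : ℝ} (hr : 3 ≤ r) : 1 < Real.log r := by
  rw [Real.lt_log_iff_exp_lt (by linarith)]
  linarith [Real.exp_one_lt_three]

theorem integrableOn_norm_ge_iff {E : Type*} [NormedAddCommGroup E] [NormedSpace ℝ E]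
    [FiniteDimensional ℝ E] [Nontrivial E] [MeasurableSpace E] [BorelSpace E]
    (μ : Measure E) [μ.IsAddHaarMeasure] {R : ℝ} (hR : 0 < R) (f : ℝ → ℝ) :
    IntegrableOn (fun x : E => f ‖x‖) {x : E | R ≤ ‖x‖} μ ↔
      IntegrableOn (fun r => r ^ (Module.finrank ℝ E - 1) * f r) (Set.Ioi R) := by
  have hmeas : MeasurableSet {x : E | R ≤ ‖x‖} := measurableSet_le measurable_const measurable_norm
  have hind : {x : E | R ≤ ‖x‖}.indicator (fun x => f ‖x‖)
      = fun x => (Set.Ici R).indicator f ‖x‖ := by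
    ext x
    simp [Set.indicator]
  have hind' : (fun r : ℝ => r ^ (Module.finrank ℝ E - 1) • (Set.Ici R).indicator f r)
      = (Set.Ici R).indicator (fun r => r ^ (Module.finrank ℝ E - 1) * f r) := by
    ext r
    simp [Set.indicator]
  rw [← integrable_indicator_iff hmeas, hind, integrable_fun_norm_addHaar μ, hind',
    integrableOn_indicator_iff measurableSet_Ici,
    Set.inter_eq_left.2 (Set.Ici_subset_Ioi.2 hR), integrableOn_Ici_iff_integrableOn_Ioi]

theorem invRpowMulLog_sq {a r : ℝ} (hr : 0 < r) :
    invRpowMulLog a r ^ 2 = (r ^ (2 * a) * Real.log r ^ 2)⁻¹ := by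
  rw [invRpowMulLog, inv_pow, mul_pow, ← Real.rpow_natCast (r ^ a), ← Real.rpow_mul hr.le]
  congr 3
  push_cast
  ring

theorem pow_mul_invRpowMulLog_sq {N : ℕ} (hN : N ≠ 0) {r : ℝ} (hr : 0 < r) :
    r ^ (N - 1) * invRpowMulLog ((N : ℝ) / 2) r ^ 2 = r⁻¹ / Real.log r ^ 2 := by
  obtain ⟨n, rfl⟩ := Nat.exists_eq_succ_of_ne_zero hN
  rw [invRpowMulLog_sq hr, mul_div_cancel₀ _ two_ne_zero, Real.rpow_natCast, Nat.succ_sub_one,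
    pow_succ, mul_inv, mul_inv]
  have : r ^ n ≠ 0 := by positivity
  rw [div_eq_mul_inv, ← mul_assoc, ← mul_assoc, mul_inv_cancel₀ this, one_mul]

theorem log_invRpowMulLog_sq {a r : ℝ} (hr : 1 < r) :
    Real.log (invRpowMulLog a r ^ 2) = -(2 * a * Real.log r + 2 * Real.log (Real.log r)) := by
  have h0 : 0 < r := by linarith
  have hl : Real.log r ≠ 0 := (Real.log_pos hr).ne'
  rw [invRpowMulLog_sq h0, Real.log_inv, Real.log_mul (Real.rpow_pos_of_pos h0 _).ne'
    (pow_ne_zero 2 hl), Real.log_rpow h0, Real.log_pow]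
  push_cast
  ring

theorem log_invRpowMulLog_sq_le {a r : ℝ} (hr : 3 ≤ r) :
    Real.log (invRpowMulLog a r ^ 2) ≤ -(2 * a * Real.log r) := by
  rw [log_invRpowMulLog_sq (by linarith)]
  linarith [Real.log_nonneg (one_lt_log_of_three_le hr).le]

theorem hasDerivAt_invRpowMulLog {a r : ℝ} (hr : 1 < r) :
    HasDerivAt (invRpowMulLog a) (-(invRpowMulLog a r * ((a + (Real.log r)⁻¹) / r))) r := by
  have h0 : 0 < r := by linarith
  have hl : Real.log r ≠ 0 := (Real.log_pos hr).ne'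
  have hp : r ^ a ≠ 0 := (Real.rpow_pos_of_pos h0 a).ne'
  have h := ((Real.hasDerivAt_rpow_const (p := a) (Or.inl h0.ne')).mul
    (Real.hasDerivAt_log h0.ne')).inv (mul_ne_zero hp hl)
  refine h.congr_deriv ?_
  simp only [invRpowMulLog, Pi.mul_apply, Real.rpow_sub_one h0.ne']
  field_simp

theorem norm_fderiv_comp_norm_le {E : Type*} [NormedAddCommGroup E] [InnerProductSpace ℝ E]
    {g : ℝ → ℝ} {g' : ℝ} {x : E} (hx : x ≠ 0) (hg : HasDerivAt g g' ‖x‖) :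
    ‖fderiv ℝ (fun y : E => g ‖y‖) x‖ ≤ |g'| := by
  have hd : DifferentiableAt ℝ (fun y : E => ‖y‖) x := differentiableAt_id.norm ℝ hx
  have h := hg.comp_hasFDerivAt x hd.hasFDerivAt
  have h1 : ‖fderiv ℝ (fun y : E => ‖y‖) x‖ ≤ 1 := by
    simpa using norm_fderiv_le_of_lipschitz ℝ (lipschitzWith_one_norm (E := E)) (x₀ := x)
  rw [show fderiv ℝ (fun y : E => g ‖y‖) x = _ from h.fderiv, norm_smul, Real.norm_eq_abs]
  exact mul_le_of_le_one_right (abs_nonneg _) h1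

theorem norm_fderiv_invRpowMulLog_norm_le {E : Type*} [NormedAddCommGroup E]
    [InnerProductSpace ℝ E] {a : ℝ} (ha : 0 ≤ a) {x : E} (hx : 3 ≤ ‖x‖) :
    ‖fderiv ℝ (fun y : E => invRpowMulLog a ‖y‖) x‖ ≤ (a + 1) * |invRpowMulLog a ‖x‖| := by
  have hl := one_lt_log_of_three_le hx
  have hx0 : x ≠ 0 := norm_pos_iff.1 (by linarith)
  refine (norm_fderiv_comp_norm_le hx0 (hasDerivAt_invRpowMulLog (by linarith))).trans ?_
  have hinv : (Real.log ‖x‖)⁻¹ ≤ 1 := inv_le_one_of_one_le₀ hl.le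
  have hpos : 0 ≤ (a + (Real.log ‖x‖)⁻¹) / ‖x‖ := by positivity
  rw [abs_neg, abs_mul, abs_of_nonneg hpos, mul_comm]
  gcongr
  rw [div_le_iff₀ (by linarith)]
  nlinarith

theorem not_integrableOn_inv_mul_log_inv (R : ℝ) :
    ¬ IntegrableOn (fun r : ℝ => r⁻¹ * (Real.log r)⁻¹) (Set.Ioi R) := by
  have hder : ∀ r : ℝ, 1 < r →
      HasDerivAt (fun r => Real.log (Real.log r)) (r⁻¹ * (Real.log r)⁻¹) r := fun r hr => by
    simpa [div_eq_mul_inv] using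
      (Real.hasDerivAt_log (by linarith : r ≠ 0)).log (Real.log_pos hr).ne'
  refine not_integrableOn_of_tendsto_norm_atTop_of_deriv_isBigO_filter Filter.atTop
    (Filter.Ioi_mem_atTop R) (f := fun r => Real.log (Real.log r)) ?_ ?_ ?_
  · filter_upwards [Filter.eventually_gt_atTop 1] with r hr using (hder r hr).differentiableAt
  · exact tendsto_norm_atTop_atTop.comp
      (Real.tendsto_log_atTop.comp Real.tendsto_log_atTop)
  · refine Filter.EventuallyEq.isBigO ?_
    filter_upwards [Filter.eventually_gt_atTop 1] with r hr using (hder r hr).deriv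

theorem not_integrableOn_pow_mul_invRpowMulLog_sq_mul_log {N : ℕ} (hN : N ≠ 0) :
    ¬ IntegrableOn (fun r => r ^ (N - 1) * (invRpowMulLog ((N : ℝ) / 2) r ^ 2 *
      Real.log (invRpowMulLog ((N : ℝ) / 2) r ^ 2))) (Set.Ioi 3) := by
  refine fun h => not_integrableOn_inv_mul_log_inv 3 (Integrable.mono h (by measurability) ?_)
  refine (ae_restrict_iff' measurableSet_Ioi).2 (.of_forall fun r (hr : 3 < r) => ?_)
  have hl := one_lt_log_of_three_le hr.le
  have hN1 : (1 : ℝ) ≤ N := by exact_mod_cast Nat.one_le_iff_ne_zero.2 hN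
  have hlog : Real.log r ≤ |Real.log (invRpowMulLog ((N : ℝ) / 2) r ^ 2)| := by
    refine le_trans ?_ (neg_le_abs _)
    have := log_invRpowMulLog_sq_le (a := (N : ℝ) / 2) hr.le
    nlinarith
  rw [← mul_assoc, pow_mul_invRpowMulLog_sq hN (by linarith), norm_mul (r⁻¹ / _),
    Real.norm_of_nonneg (by positivity), Real.norm_of_nonneg (by positivity), Real.norm_eq_abs]
  calc r⁻¹ * (Real.log r)⁻¹ = r⁻¹ / Real.log r ^ 2 * Real.log r := by field_simp
    _ ≤ r⁻¹ / Real.log r ^ 2 * |Real.log (invRpowMulLog ((N : ℝ) / 2) r ^ 2)| := by gcongr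

theorem lintegral_ofReal_neg_eq_top {α : Type*} [MeasurableSpace α] {μ : Measure α} {f : α → ℝ}
    (hf : AEStronglyMeasurable f μ) (hle : f ≤ᵐ[μ] 0) (hint : ¬ Integrable f μ) :
    ∫⁻ x, ENNReal.ofReal (-f x) ∂μ = ⊤ := by
  by_contra h
  refine hint (integrable_neg_iff.1 ⟨hf.neg, ?_⟩)
  refine (hasFiniteIntegral_iff_ofReal (f := -f) (hle.mono fun x hx => neg_nonneg.2 hx)).2 ?_
  exact lt_top_iff_ne_top.2 h

/-- On `Ω = {|x| ≥ 3}`, `v²` and `‖∇v‖²` are integrable, `v² log(v²) ≤ 0`, yet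
`v² log(v²)` is not integrable and its integral is `−∞`. -/
theorem stmt_19 (N : ℕ) (hN : 2 ≤ N) :
    IntegrableOn (fun x : EuclideanSpace ℝ (Fin N) => (vfun N x) ^ 2)
      {x : EuclideanSpace ℝ (Fin N) | 3 ≤ ‖x‖} ∧
    IntegrableOn (fun x : EuclideanSpace ℝ (Fin N) => ‖fderiv ℝ (vfun N) x‖ ^ 2)
      {x : EuclideanSpace ℝ (Fin N) | 3 ≤ ‖x‖} ∧
    (∀ x : EuclideanSpace ℝ (Fin N), 3 ≤ ‖x‖ →
      (vfun N x) ^ 2 * Real.log ((vfun N x) ^ 2) ≤ 0) ∧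
    ¬ IntegrableOn
        (fun x : EuclideanSpace ℝ (Fin N) => (vfun N x) ^ 2 * Real.log ((vfun N x) ^ 2))
        {x : EuclideanSpace ℝ (Fin N) | 3 ≤ ‖x‖} ∧
    ∫⁻ x in {x : EuclideanSpace ℝ (Fin N) | 3 ≤ ‖x‖},
        ENNReal.ofReal (-((vfun N x) ^ 2 * Real.log ((vfun N x) ^ 2))) = ⊤ := by
  have hN0 : N ≠ 0 := by omega
  have : Nonempty (Fin N) := ⟨⟨0, by omega⟩⟩
  have hmeas : MeasurableSet {x : EuclideanSpace ℝ (Fin N) | 3 ≤ ‖x‖} :=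
    measurableSet_le measurable_const measurable_norm
  have hvmeas : Measurable (vfun N) := by
    unfold vfun
    fun_prop
  have hsq : IntegrableOn (fun x => vfun N x ^ 2) {x : EuclideanSpace ℝ (Fin N) | 3 ≤ ‖x‖} := by
    refine (integrableOn_norm_ge_iff volume three_pos
      (fun r => invRpowMulLog ((N : ℝ) / 2) r ^ 2)).2 ?_
    rw [finrank_euclideanSpace_fin]
    refine (integrableOn_inv_div_log_sq_Ioi (by norm_num : (1 : ℝ) < 3)).congr_fun
      (fun r (hr : 3 < r) => ?_) measurableSet_Ioi
    exact (pow_mul_invRpowMulLog_sq hN0 (by linarith)).symm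
  have hnonpos : ∀ x : EuclideanSpace ℝ (Fin N), 3 ≤ ‖x‖ →
      vfun N x ^ 2 * Real.log (vfun N x ^ 2) ≤ 0 := fun x hx => by
    refine mul_nonpos_of_nonneg_of_nonpos (sq_nonneg _)
      ((log_invRpowMulLog_sq_le (a := (N : ℝ) / 2) hx).trans ?_)
    have := one_lt_log_of_three_le hx
    rw [neg_nonpos]
    positivity
  have hnot : ¬ IntegrableOn (fun x => vfun N x ^ 2 * Real.log (vfun N x ^ 2))
      {x : EuclideanSpace ℝ (Fin N) | 3 ≤ ‖x‖} := by
    refine fun h => not_integrableOn_pow_mul_invRpowMulLog_sq_mul_log hN0 ?_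
    simpa only [finrank_euclideanSpace_fin] using
      (integrableOn_norm_ge_iff volume three_pos (fun r => invRpowMulLog ((N : ℝ) / 2) r ^ 2 *
        Real.log (invRpowMulLog ((N : ℝ) / 2) r ^ 2))).1 h
  refine ⟨hsq, ?_, hnonpos, hnot, lintegral_ofReal_neg_eq_top ?_ ?_ hnot⟩
  · refine Integrable.mono' (hsq.const_mul (((N : ℝ) / 2 + 1) ^ 2))
      ((measurable_fderiv ℝ (vfun N)).norm.pow_const 2).aestronglyMeasurable
      ((ae_restrict_iff' hmeas).2 (.of_forall fun x hx => ?_))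
    rw [Real.norm_of_nonneg (sq_nonneg _), ← sq_abs (vfun N x), ← mul_pow]
    exact pow_le_pow_left₀ (norm_nonneg _)
      (norm_fderiv_invRpowMulLog_norm_le (by positivity) hx) 2
  · exact (by fun_prop : Measurable fun x => vfun N x ^ 2 *
      Real.log (vfun N x ^ 2)).aestronglyMeasurable
  · exact (ae_restrict_iff' hmeas).2 (.of_forall hnonpos)
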